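/- arXiv:1704.01448 — 10 statements merged into one kernel-verified Lean document; each statement's English description precedes it below -/
import Mathlib

section
/- Let X be a separable real Banach space and γ a centered Gaussian measure on X. Then the supremum λ₀ = sup{⟨R_γ f, f⟩ : f ∈ X*, ‖f‖_{X*} ≤ 1} is finite and is attained: there exists f₀ ∈ X* with ‖f₀‖_{X*} = 1 such that ⟨R_γ f₀, f₀⟩ = λ₀. -/
open MeasureTheory ProbabilityTheory

/-- A Borel probability measure `γ` on a normed space `X` is a centered Gaussian measure
if every continuous linear functional pushes it forward to a centered Gaussian on `ℝ`. -/
def IsCenteredGaussian {X : Type*} [NormedAddCommGroup X] [NormedSpace ℝ X]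
    [MeasurableSpace X] (γ : Measure X) : Prop :=
  IsProbabilityMeasure γ ∧
    ∀ f : X →L[ℝ] ℝ, ∃ v : NNReal, γ.map f = gaussianReal 0 v

lemma IsCenteredGaussian.isGaussian {X : Type*} [NormedAddCommGroup X] [NormedSpace ℝ X]
    [MeasurableSpace X] [BorelSpace X] {γ : Measure X} (hγ : IsCenteredGaussian γ) :
    IsGaussian γ := by
  refine isGaussian_of_isGaussian_map fun L ↦ ?_
  obtain ⟨v, hv⟩ := hγ.2 L
  rw [hv]
  infer_instance

/-- The second moment of a finite-second-moment measure along functionals in the closed dual unit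
ball attains its maximum, by weak-* compactness and dominated convergence. -/
lemma exists_forall_integral_sq_le {X : Type*} [NormedAddCommGroup X] [NormedSpace ℝ X]
    [TopologicalSpace.SeparableSpace X] [MeasurableSpace X] [BorelSpace X] {γ : Measure X}
    (hγ : Integrable (fun x ↦ ‖x‖ ^ 2) γ) :
    ∃ f : X →L[ℝ] ℝ, ‖f‖ ≤ 1 ∧
      ∀ g : X →L[ℝ] ℝ, ‖g‖ ≤ 1 → ∫ x, g x * g x ∂γ ≤ ∫ x, f x * f x ∂γ := by
  let K : Set (WeakDual ℝ X) :=
    WeakDual.toStrongDual ⁻¹' Metric.closedBall (0 : StrongDual ℝ X) 1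
  have norm_le (f : WeakDual ℝ X) : f ∈ K ↔ ‖WeakDual.toStrongDual f‖ ≤ 1 := by simp [K]
  have hK : IsCompact K := WeakDual.isCompact_closedBall 0 1
  have : CompactSpace K := isCompact_iff_compactSpace.mp hK
  have : TopologicalSpace.MetrizableSpace K := WeakDual.metrizable_of_isCompact ℝ X K hK
  have hcont : Continuous fun f : K ↦ ∫ x, f.1 x * f.1 x ∂γ := by
    refine continuous_of_dominated (bound := fun x ↦ ‖x‖ ^ 2) (fun f ↦ ?_) (fun f ↦ ?_) hγ ?_
    · exact ((map_continuous f.1).mul (map_continuous f.1)).measurable.aestronglyMeasurable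
    · refine .of_forall fun x ↦ ?_
      have h : ‖f.1 x‖ ≤ ‖x‖ :=
        (WeakDual.toStrongDual f.1).le_of_opNorm_le ((norm_le f.1).1 f.2) x |>.trans
          (one_mul _).le
      rw [norm_mul, ← pow_two]
      gcongr
    · refine .of_forall fun x ↦ ?_
      have h : Continuous fun f : K ↦ f.1 x :=
        (WeakDual.eval_continuous x).comp continuous_subtype_val
      exact h.mul h
  obtain ⟨f, -, hf⟩ := isCompact_univ.exists_isMaxOn
    ⟨(⟨0, by simp [norm_le]⟩ : K), Set.mem_univ _⟩ hcont.continuousOn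
  exact ⟨WeakDual.toStrongDual f.1, (norm_le f.1).1 f.2,
    fun g hg ↦ hf (Set.mem_univ (⟨StrongDual.toWeakDual g, (norm_le _).2 hg⟩ : K))⟩

/-- A functional in the closed dual unit ball can be replaced by one of unit norm without
decreasing a quadratic form that is nonnegative. -/
lemma exists_norm_eq_one_apply_le {E : Type*} [NormedAddCommGroup E] [NormedSpace ℝ E]
    [Nontrivial E] {q : E → ℝ} (hq : ∀ f, 0 ≤ q f) (hsmul : ∀ (c : ℝ) f, q (c • f) = c ^ 2 * q f)
    {f : E} (hf : ‖f‖ ≤ 1) : ∃ g : E, ‖g‖ = 1 ∧ q f ≤ q g := by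
  rcases eq_or_ne f 0 with rfl | h0
  · obtain ⟨g, hg⟩ := exists_norm_eq E zero_le_one
    refine ⟨g, hg, ?_⟩
    have h := hsmul 0 0
    simp only [smul_zero, ne_eq, OfNat.ofNat_ne_zero, not_false_eq_true, zero_pow, zero_mul] at h
    exact h.le.trans (hq g)
  · refine ⟨‖f‖⁻¹ • f, norm_smul_inv_norm h0, ?_⟩
    rw [hsmul]
    have h : 1 ≤ ‖f‖⁻¹ := (one_le_inv₀ (norm_pos_iff.2 h0)).2 hf
    exact le_mul_of_one_le_left (hq f) (one_le_pow₀ h)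

/-- the Rayleigh quotient supremum `λ₀ = sup {⟨R_γ f, f⟩ : ‖f‖ ≤ 1}` is
finite and attained at some `f₀` of unit norm. -/
theorem rayleigh_sup_attained {X : Type*} [NormedAddCommGroup X] [NormedSpace ℝ X]
    [CompleteSpace X] [TopologicalSpace.SeparableSpace X] [Nontrivial X]
    [MeasurableSpace X] [BorelSpace X]
    (γ : Measure X) (hγ : IsCenteredGaussian γ)
    (R : (X →L[ℝ] ℝ) →L[ℝ] X)
    (hR : ∀ f g : X →L[ℝ] ℝ, g (R f) = ∫ x, f x * g x ∂γ) :
    ∃ f₀ : X →L[ℝ] ℝ, ‖f₀‖ = 1 ∧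
      IsLUB {c : ℝ | ∃ f : X →L[ℝ] ℝ, ‖f‖ ≤ 1 ∧ c = f (R f)} (f₀ (R f₀)) := by
  have := hγ.isGaussian
  have : SecondCountableTopology X := UniformSpace.secondCountable_of_separable X
  obtain ⟨f, hf, hmax⟩ :=
    exists_forall_integral_sq_le ((IsGaussian.memLp_two_id (μ := γ)).integrable_norm_pow two_ne_zero)
  obtain ⟨v, hv⟩ := exists_ne (0 : X)
  obtain ⟨φ, hφ, -⟩ := exists_dual_vector ℝ v (norm_ne_zero_iff.2 hv)
  have : Nontrivial (X →L[ℝ] ℝ) := ⟨φ, 0, fun h ↦ by simp [h] at hφ⟩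
  obtain ⟨f₀, hf₀, hle⟩ := exists_norm_eq_one_apply_le (q := fun f : X →L[ℝ] ℝ ↦ f (R f))
    (fun f ↦ (hR f f).symm ▸ integral_nonneg fun x ↦ mul_self_nonneg (f x))
    (fun c f ↦ by simp only [map_smul, smul_apply, smul_eq_mul]; ring) hf
  refine ⟨f₀, hf₀, ?_, fun b hb ↦ hb ⟨f₀, hf₀.le, rfl⟩⟩
  rintro _ ⟨g, hg, rfl⟩
  exact ((hR g g).trans_le ((hmax g hg).trans_eq (hR f f).symm)).trans hle
end

section
/- Let X be a separable real Banach space, γ a centered Gaussian measure on X, and f₀ ∈ X* with ‖f₀‖_{X*} = 1 such that λ₀ = ⟨R_γ f₀, f₀⟩ = sup{⟨R_γ f, f⟩ : ‖f‖_{X*} ≤ 1} > 0. Set x₀ = λ₀⁻¹ R_γ f₀. Then ⟨x₀, f₀⟩ = 1 and ‖x₀‖_X = 1. -/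
open MeasureTheory ProbabilityTheory

/-- A symmetric positive semidefinite form bounded by `c` on the diagonal of the dual unit ball
satisfies `‖R f‖ ≤ c` for every `f` in that ball. -/
theorem norm_apply_le_of_symm_of_nonneg {X : Type*} [NormedAddCommGroup X] [NormedSpace ℝ X]
    {R : (X →L[ℝ] ℝ) →L[ℝ] X} (hsymm : ∀ f g : X →L[ℝ] ℝ, g (R f) = f (R g))
    (hnonneg : ∀ f : X →L[ℝ] ℝ, 0 ≤ f (R f)) {c : ℝ}
    (hc : ∀ f : X →L[ℝ] ℝ, ‖f‖ ≤ 1 → f (R f) ≤ c) {f : X →L[ℝ] ℝ} (hf : ‖f‖ ≤ 1) :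
    ‖R f‖ ≤ c := by
  obtain ⟨g, hg, hgR⟩ := exists_dual_vector'' ℝ (R f)
  have h := hnonneg (f - g)
  simp only [map_sub, sub_apply] at h
  have hgR' : g (R f) = ‖R f‖ := by simpa using hgR
  linarith [hsymm f g, hc f hf, hc g hg]

/-- with `λ₀ = ⟨R_γ f₀, f₀⟩ = sup {⟨R_γ f, f⟩ : ‖f‖ ≤ 1} > 0`, `‖f₀‖ = 1`
and `x₀ = λ₀⁻¹ R_γ f₀`, one has `⟨x₀, f₀⟩ = 1` and `‖x₀‖ = 1`. -/
theorem pivot_vector_normalized {X : Type*} [NormedAddCommGroup X] [NormedSpace ℝ X]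
    [CompleteSpace X] [TopologicalSpace.SeparableSpace X]
    [MeasurableSpace X] [BorelSpace X]
    (γ : Measure X) (hγ : IsCenteredGaussian γ)
    (R : (X →L[ℝ] ℝ) →L[ℝ] X)
    (hR : ∀ f g : X →L[ℝ] ℝ, g (R f) = ∫ x, f x * g x ∂γ)
    (f₀ : X →L[ℝ] ℝ) (hf₀ : ‖f₀‖ = 1)
    (lam₀ : ℝ) (hlam₀ : lam₀ = f₀ (R f₀))
    (hsup : IsLUB {c : ℝ | ∃ f : X →L[ℝ] ℝ, ‖f‖ ≤ 1 ∧ c = f (R f)} lam₀)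
    (hpos : 0 < lam₀)
    (x₀ : X) (hx₀ : x₀ = lam₀⁻¹ • R f₀) :
    f₀ x₀ = 1 ∧ ‖x₀‖ = 1 := by
  have hsymm : ∀ f g : X →L[ℝ] ℝ, g (R f) = f (R g) := fun f g ↦ by
    simp only [hR, mul_comm]
  have hnonneg : ∀ f : X →L[ℝ] ℝ, 0 ≤ f (R f) := fun f ↦ by
    rw [hR]
    exact integral_nonneg fun x ↦ mul_self_nonneg (f x)
  have hle : ‖R f₀‖ ≤ lam₀ :=
    norm_apply_le_of_symm_of_nonneg hsymm hnonneg (fun f hf ↦ hsup.1 ⟨f, hf, rfl⟩) hf₀.le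
  have hone : f₀ x₀ = 1 := by
    rw [hx₀, map_smul, ← hlam₀, smul_eq_mul, inv_mul_cancel₀ hpos.ne']
  refine ⟨hone, le_antisymm ?_ ?_⟩
  · rw [hx₀, norm_smul, norm_inv, Real.norm_of_nonneg hpos.le]
    exact inv_mul_le_one_of_le₀ hle hpos.le
  · simpa [hone, hf₀] using f₀.le_opNorm x₀
end

section
/- Let X be a separable real Banach space, γ a centered Gaussian measure on X, f₀ ∈ X* with ‖f₀‖_{X*} = 1, λ₀ = ⟨R_γ f₀, f₀⟩ > 0, x₀ = λ₀⁻¹ R_γ f₀, P₀ x = ⟨x,f₀⟩x₀, and γ₁ = γ∘(I−P₀)⁻¹. Then for every Borel set B ⊆ X, γ(B) = ∫_ℝ γ₁(B − t x₀) · (2πλ₀)^{-1/2} e^{−t²/(2λ₀)} dt, where B − t x₀ = {x − t x₀ : x ∈ B}. -/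
open MeasureTheory ProbabilityTheory

namespace IsCenteredGaussian

variable {X : Type*} [NormedAddCommGroup X] [NormedSpace ℝ X] [MeasurableSpace X] [BorelSpace X]
  {γ : Measure X}

lemma isGaussian_s5 (hγ : IsCenteredGaussian γ) : IsGaussian γ :=
  isGaussian_of_map_eq_gaussianReal fun f => ⟨0, hγ.2 f⟩

lemma integral_eq_zero (hγ : IsCenteredGaussian γ) (f : X →L[ℝ] ℝ) : ∫ x, f x ∂γ = 0 := by
  obtain ⟨v, hv⟩ := hγ.2 f
  have h := integral_map (μ := γ) (φ := f) (f := fun t : ℝ => t) (by fun_prop) (by fun_prop)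
  rw [← h, hv, integral_id_gaussianReal]

lemma covariance_eq_integral (hγ : IsCenteredGaussian γ) (f g : X →L[ℝ] ℝ) :
    cov[f, g; γ] = ∫ x, f x * g x ∂γ := by
  simp only [covariance, hγ.integral_eq_zero, sub_zero]

lemma map_eq_gaussianReal (hγ : IsCenteredGaussian γ) (f : X →L[ℝ] ℝ) :
    γ.map f = gaussianReal 0 (∫ x, f x * f x ∂γ).toNNReal := by
  have := hγ.isGaussian_s5
  rw [IsGaussian.map_eq_gaussianReal, hγ.integral_eq_zero, ← hγ.covariance_eq_integral,
    covariance_self (by fun_prop)]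

/-- If `x₀` represents the normalized covariance with `f₀`, then the residual `x - f₀ x • x₀` is
independent of `f₀`. -/
lemma indepFun_sub_smul [CompleteSpace X] [SecondCountableTopology X]
    (hγ : IsCenteredGaussian γ) {f₀ : X →L[ℝ] ℝ} {x₀ : X}
    (hx₀ : ∀ g : X →L[ℝ] ℝ, ∫ x, f₀ x * g x ∂γ = g x₀ * ∫ x, f₀ x * f₀ x ∂γ) :
    IndepFun (fun x => x - f₀ x • x₀) f₀ γ := by
  have := hγ.isGaussian_s5
  refine HasGaussianLaw.indepFun_of_covariance_strongDual ?_ fun L M => ?_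
  · exact IsGaussian.hasGaussianLaw_id.map_fun
      ((ContinuousLinearMap.id ℝ X - f₀.smulRight x₀).prod f₀)
  · have hL : L ∘ (fun x => x - f₀ x • x₀) = ⇑(L - L x₀ • f₀) := by
      ext x
      simp [mul_comm]
    have hM : M ∘ f₀ = M 1 • ⇑f₀ := by
      ext x
      simpa [mul_comm] using M.map_smul (f₀ x) 1
    have hint (f g : X →L[ℝ] ℝ) : Integrable (fun x => f x * g x) γ :=
      (IsGaussian.memLp_dual γ f 2 (by simp)).integrable_mul
        (IsGaussian.memLp_dual γ g 2 (by simp))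
    have hcov : ∫ x, (L - L x₀ • f₀) x * f₀ x ∂γ = 0 := calc
      _ = ∫ x, f₀ x * L x - L x₀ * (f₀ x * f₀ x) ∂γ := by
        congr with x
        simp
        ring
      _ = 0 := by
        rw [integral_sub (hint _ _) ((hint _ _).const_mul _), integral_const_mul, hx₀, sub_self]
    rw [hL, hM, covariance_smul_right, hγ.covariance_eq_integral, hcov, mul_zero]

end IsCenteredGaussian

/-- Disintegration of a measure along a functional `f₀` that is independent of the residual
`x - f₀ x • x₀`. -/
lemma measure_eq_lintegral_of_indepFun_sub_smul {X : Type*} [NormedAddCommGroup X]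
    [NormedSpace ℝ X] [SecondCountableTopology X] [MeasurableSpace X] [BorelSpace X]
    {γ : Measure X} [IsFiniteMeasure γ] {f₀ : X →L[ℝ] ℝ} {x₀ : X}
    (hind : IndepFun (fun x => x - f₀ x • x₀) f₀ γ) {B : Set X} (hB : MeasurableSet B) :
    γ B = ∫⁻ t, γ.map (fun x => x - f₀ x • x₀) ((fun x => x + t • x₀) ⁻¹' B) ∂(γ.map f₀) := by
  have hadd : Measurable (fun p : X × ℝ => p.1 + p.2 • x₀) := by fun_prop
  have hpair : Measurable (fun x => (x - f₀ x • x₀, f₀ x)) := by fun_prop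
  have hmap : γ.map (fun x => (x - f₀ x • x₀, f₀ x)) =
      (γ.map (fun x => x - f₀ x • x₀)).prod (γ.map f₀) :=
    (indepFun_iff_map_prod_eq_prod_map_map (by fun_prop) (by fun_prop)).1 hind
  calc γ B = γ.map (fun x => (x - f₀ x • x₀, f₀ x)) ((fun p => p.1 + p.2 • x₀) ⁻¹' B) := by
        rw [Measure.map_apply hpair (hadd hB)]
        simp [Set.preimage]
    _ = _ := by
        rw [hmap, Measure.prod_apply_symm (hadd hB)]
        rfl

/-- deconditioning formula
`γ(B) = ∫_ℝ γ₁(B - t x₀) (2πλ₀)^{-1/2} e^{-t²/(2λ₀)} dt`, where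
`γ₁ = γ ∘ (I - P₀)⁻¹` and `B - t x₀ = {x - t x₀ : x ∈ B}`. -/
theorem deconditioning_one_step {X : Type*} [NormedAddCommGroup X] [NormedSpace ℝ X]
    [CompleteSpace X] [TopologicalSpace.SeparableSpace X]
    [MeasurableSpace X] [BorelSpace X]
    (γ : Measure X) (hγ : IsCenteredGaussian γ)
    (R : (X →L[ℝ] ℝ) →L[ℝ] X)
    (hR : ∀ f g : X →L[ℝ] ℝ, g (R f) = ∫ x, f x * g x ∂γ)
    (f₀ : X →L[ℝ] ℝ) (hf₀ : ‖f₀‖ = 1)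
    (lam₀ : ℝ) (hlam₀ : lam₀ = f₀ (R f₀)) (hpos : 0 < lam₀)
    (x₀ : X) (hx₀ : x₀ = lam₀⁻¹ • R f₀)
    (γ₁ : Measure X) (hγ₁ : γ₁ = γ.map (fun x => x - f₀ x • x₀)) :
    ∀ B : Set X, MeasurableSet B →
      (γ B).toReal =
        ∫ t : ℝ, (γ₁ ((fun x => x - t • x₀) '' B)).toReal *
          ((Real.sqrt (2 * Real.pi * lam₀))⁻¹ * Real.exp (-(t ^ 2) / (2 * lam₀))) := by
  intro B hB
  have := hγ.1
  have : SecondCountableTopology X := UniformSpace.secondCountable_of_separable X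
  have hlam : ∫ x, f₀ x * f₀ x ∂γ = lam₀ := by rw [hlam₀, hR]
  have hv : lam₀.toNNReal ≠ 0 := by simpa using hpos
  have hind : IndepFun (fun x => x - f₀ x • x₀) f₀ γ := by
    refine hγ.indepFun_sub_smul fun g => ?_
    rw [hlam, ← hR, hx₀, map_smul, smul_eq_mul]
    field_simp
  have himg (t : ℝ) : (fun x => x - t • x₀) '' B = (fun x => x + t • x₀) ⁻¹' B :=
    congrFun (Set.image_eq_preimage_of_inverse (sub_add_cancel · _) (add_sub_cancel_right · _)) B
  have : IsFiniteMeasure γ₁ := by rw [hγ₁]; infer_instance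
  have hmeas : Measurable fun t : ℝ => γ₁ ((fun x => x + t • x₀) ⁻¹' B) :=
    measurable_measure_prodMk_right
      ((by fun_prop : Measurable (fun p : X × ℝ => p.1 + p.2 • x₀)) hB)
  rw [measure_eq_lintegral_of_indepFun_sub_smul hind hB, ← hγ₁, hγ.map_eq_gaussianReal, hlam,
    ← integral_toReal hmeas.aemeasurable (ae_of_all _ fun _ => measure_lt_top _ _),
    integral_gaussianReal_eq_integral_smul hv]
  congr with t
  rw [himg, smul_eq_mul, mul_comm, gaussianPDFReal, sub_zero, Real.coe_toNNReal _ hpos.le]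
end

section
/- Under the iterative decomposition scheme applied to a centered Gaussian measure γ on a separable Banach space X, with λ_n > 0 for all n: for every n one has ‖x_n‖_X = 1 and ⟨x_n, f_n⟩ = 1, and for all k > l one has ⟨x_k, f_l⟩ = 0. -/
open MeasureTheory ProbabilityTheory

/-- in the iterative decomposition scheme, `‖x_n‖ = 1`, `⟨x_n, f_n⟩ = 1`,
and `⟨x_k, f_l⟩ = 0` for `k > l`. -/
theorem scheme_biorthogonality
    {X : Type*} [NormedAddCommGroup X] [NormedSpace ℝ X]
    [CompleteSpace X] [TopologicalSpace.SeparableSpace X]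
    [MeasurableSpace X] [BorelSpace X]
    (γ : Measure X) (γs : ℕ → Measure X)
    (Rs : ℕ → (X →L[ℝ] ℝ) →L[ℝ] X) (lam : ℕ → ℝ)
    (fs : ℕ → X →L[ℝ] ℝ) (xs : ℕ → X)
    -- the iterative decomposition scheme:
    (hγ0 : γs 0 = γ)
    (hGauss : ∀ n, IsCenteredGaussian (γs n))
    (hRs : ∀ n (f g : X →L[ℝ] ℝ), g (Rs n f) = ∫ x, f x * g x ∂(γs n))
    (hsup : ∀ n, IsLUB {c : ℝ | ∃ f : X →L[ℝ] ℝ, ‖f‖ ≤ 1 ∧ c = f (Rs n f)} (lam n))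
    (hfs : ∀ n, ‖fs n‖ = 1 ∧ (fs n) (Rs n (fs n)) = lam n)
    (hpos : ∀ n, 0 < lam n)
    (hxs : ∀ n, xs n = (lam n)⁻¹ • Rs n (fs n))
    (hγsucc : ∀ n, γs (n + 1) = (γs n).map (fun x => x - (fs n) x • xs n))
    (hRrec : ∀ n (f : X →L[ℝ] ℝ), Rs (n + 1) f = Rs n f - (lam n * f (xs n)) • xs n)
    :
    (∀ n, ‖xs n‖ = 1 ∧ (fs n) (xs n) = 1) ∧
    (∀ k l, l < k → (fs l) (xs k) = 0) := by
  have hsymm : ∀ n (f g : X →L[ℝ] ℝ), g (Rs n f) = f (Rs n g) := fun n f g => by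
    rw [hRs, hRs]
    simp only [mul_comm]
  have hnonneg : ∀ n (f : X →L[ℝ] ℝ), 0 ≤ f (Rs n f) := fun n f => by
    rw [hRs]
    exact integral_nonneg fun x => mul_self_nonneg (f x)
  have hpair : ∀ n (g : X →L[ℝ] ℝ), g (xs n) = (lam n)⁻¹ * g (Rs n (fs n)) := fun n g => by
    rw [hxs, map_smul, smul_eq_mul]
  have hone : ∀ n, (fs n) (xs n) = 1 := fun n => by
    rw [hpair, (hfs n).2, inv_mul_cancel₀ (hpos n).ne']
  refine ⟨fun n => ⟨le_antisymm ?_ ?_, hone n⟩, ?_⟩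
  · obtain ⟨g, hg, hgx⟩ := exists_dual_vector'' ℝ (xs n)
    have hgx' : g (xs n) = ‖xs n‖ := by simpa using hgx
    rw [← hgx', hpair, inv_mul_le_iff₀ (hpos n), mul_one]
    have hle : g (Rs n g) ≤ lam n := (hsup n).1 ⟨g, hg, rfl⟩
    have hdiff := hnonneg n (g - fs n)
    simp only [map_sub, sub_apply, (hfs n).2, hsymm n g (fs n)] at hdiff
    linarith
  · have h := (fs n).le_opNorm (xs n)
    rwa [hone, (hfs n).1, one_mul, norm_one] at h
  · have horth : ∀ k l, Rs k (fs l) = 0 → (fs l) (xs k) = 0 := fun k l h => by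
      rw [hpair, hsymm, h, map_zero, mul_zero]
    have hker : ∀ k l, l < k → Rs k (fs l) = 0 := fun k l hlk => by
      induction k, hlk using Nat.le_induction with
      | base =>
        rw [hRrec, hone, mul_one, hxs, smul_inv_smul₀ (hpos l).ne', sub_self]
      | succ k _ ih => rw [hRrec, horth k l ih, ih, mul_zero, zero_smul, sub_zero]
    exact fun k l hlk => horth k l (hker k l hlk)
end

section
/- Under the iterative decomposition scheme applied to a centered Gaussian measure γ on a separable Banach space X, with λ_n > 0 for all n, define P_{-1} = 0 and P_n x = Σ_{k=0}^{n} ⟨x − P_{k−1}x, f_k⟩ x_k. Then each P_n is a bounded linear projection (P_n ∘ P_n = P_n) whose range is span(x₀, …, x_n) and whose kernel is {x ∈ X : ⟨x, f_k⟩ = 0 for k = 0, …, n}. -/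
open MeasureTheory ProbabilityTheory

/-- The functionals of a deflation scheme with symmetric covariances are unitriangular
with respect to the deflation directions. -/
theorem deflation_apply_direction
    {X : Type*} [NormedAddCommGroup X] [NormedSpace ℝ X]
    {Rs : ℕ → (X →L[ℝ] ℝ) →L[ℝ] X} {lam : ℕ → ℝ} {fs : ℕ → X →L[ℝ] ℝ} {xs : ℕ → X}
    (hsymm : ∀ n (f g : X →L[ℝ] ℝ), g (Rs n f) = f (Rs n g))
    (hfs : ∀ n, fs n (Rs n (fs n)) = lam n)
    (hlam : ∀ n, lam n ≠ 0)
    (hxs : ∀ n, xs n = (lam n)⁻¹ • Rs n (fs n))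
    (hRrec : ∀ n (f : X →L[ℝ] ℝ), Rs (n + 1) f = Rs n f - (lam n * f (xs n)) • xs n) :
    (∀ n, fs n (xs n) = 1) ∧ ∀ n, ∀ k < n, fs k (xs n) = 0 := by
  have hone : ∀ n, fs n (xs n) = 1 := fun n => by
    rw [hxs, map_smul, hfs, smul_eq_mul, inv_mul_cancel₀ (hlam n)]
  have horth : ∀ n k, Rs n (fs k) = 0 → fs k (xs n) = 0 := fun n k h => by
    rw [hxs, map_smul, hsymm, h, map_zero, smul_zero]
  have hker : ∀ n, ∀ k < n, Rs n (fs k) = 0 := by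
    intro n
    induction n with
    | zero => simp
    | succ n ih =>
      intro k hk
      rcases Nat.lt_succ_iff_lt_or_eq.mp hk with hk | rfl
      · rw [hRrec, ih k hk, horth n k (ih k hk)]
        simp
      · rw [hRrec, hone, mul_one, hxs, smul_inv_smul₀ (hlam k), sub_self]
  exact ⟨hone, fun n k hk => horth n k (hker n k hk)⟩

section TriangularProjection

variable {X : Type*} [NormedAddCommGroup X] [NormedSpace ℝ X]
  {fs : ℕ → X →L[ℝ] ℝ} {xs : ℕ → X} {Ps : ℕ → X → X}

theorem exists_continuousLinearMap_of_recursion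
    (hP0 : ∀ x, Ps 0 x = 0)
    (hPsucc : ∀ n x, Ps (n + 1) x = Ps n x + (fs n) (x - Ps n x) • xs n) (n : ℕ) :
    ∃ T : X →L[ℝ] X, ∀ x, T x = Ps n x := by
  induction n with
  | zero => exact ⟨0, fun x => by simp [hP0]⟩
  | succ n ih =>
    obtain ⟨T, hT⟩ := ih
    refine ⟨T + ((fs n).comp (ContinuousLinearMap.id ℝ X - T)).smulRight (xs n), fun x => ?_⟩
    simp [hPsucc, hT]

theorem apply_residual_eq_zero
    (hone : ∀ n, fs n (xs n) = 1) (horth : ∀ n, ∀ k < n, fs k (xs n) = 0)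
    (hPsucc : ∀ n x, Ps (n + 1) x = Ps n x + (fs n) (x - Ps n x) • xs n)
    (n : ℕ) (x : X) : ∀ k < n, fs k (x - Ps n x) = 0 := by
  induction n with
  | zero => simp
  | succ n ih =>
    intro k hk
    rw [hPsucc, ← sub_sub, map_sub, map_smul]
    rcases Nat.lt_succ_iff_lt_or_eq.mp hk with hk | rfl
    · rw [ih k hk, horth n k hk, smul_zero, sub_zero]
    · rw [hone, smul_eq_mul, mul_one, sub_self]

theorem recursion_eq_zero_of_forall_apply_eq_zero
    (hP0 : ∀ x, Ps 0 x = 0)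
    (hPsucc : ∀ n x, Ps (n + 1) x = Ps n x + (fs n) (x - Ps n x) • xs n)
    (n : ℕ) (x : X) (hx : ∀ k < n, fs k x = 0) : Ps n x = 0 := by
  induction n with
  | zero => exact hP0 x
  | succ n ih =>
    rw [hPsucc, ih fun k hk => hx k (hk.trans n.lt_succ_self), sub_zero, hx n n.lt_succ_self,
      zero_smul, add_zero]

theorem recursion_apply_direction
    (hone : ∀ n, fs n (xs n) = 1) (horth : ∀ n, ∀ k < n, fs k (xs n) = 0)
    (hP0 : ∀ x, Ps 0 x = 0)
    (hPsucc : ∀ n x, Ps (n + 1) x = Ps n x + (fs n) (x - Ps n x) • xs n)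
    (n : ℕ) : ∀ k < n, Ps n (xs k) = xs k := by
  induction n with
  | zero => simp
  | succ n ih =>
    intro k hk
    rw [hPsucc]
    rcases Nat.lt_succ_iff_lt_or_eq.mp hk with hk | rfl
    · rw [ih k hk, sub_self, map_zero, zero_smul, add_zero]
    · rw [recursion_eq_zero_of_forall_apply_eq_zero hP0 hPsucc k (xs k) (horth k), sub_zero,
        hone, one_smul, zero_add]

theorem recursion_mem_span
    (hP0 : ∀ x, Ps 0 x = 0)
    (hPsucc : ∀ n x, Ps (n + 1) x = Ps n x + (fs n) (x - Ps n x) • xs n)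
    (n : ℕ) (x : X) : Ps n x ∈ Submodule.span ℝ (xs '' {k | k < n}) := by
  induction n with
  | zero => rw [hP0]; exact Submodule.zero_mem _
  | succ n ih =>
    rw [hPsucc]
    refine Submodule.add_mem _ (Submodule.span_mono (Set.image_mono fun k hk => ?_) ih)
      (Submodule.smul_mem _ _ (Submodule.subset_span ⟨n, n.lt_succ_self, rfl⟩))
    exact Nat.lt_succ_of_lt hk

end TriangularProjection

/-- with `P₋₁ = 0` and `P_n x = Σ_{k=0}^n ⟨x - P_{k-1}x, f_k⟩ x_k`
(encoded by `Ps (n+1) = P_n`, `Ps 0 = P₋₁ = 0`), each `P_n` is a bounded linear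
projection with range `span(x₀, …, x_n)` and kernel `{x : ⟨x, f_k⟩ = 0, k = 0, …, n}`. -/
theorem scheme_projections
    {X : Type*} [NormedAddCommGroup X] [NormedSpace ℝ X]
    [CompleteSpace X] [TopologicalSpace.SeparableSpace X]
    [MeasurableSpace X] [BorelSpace X]
    (γ : Measure X) (γs : ℕ → Measure X)
    (Rs : ℕ → (X →L[ℝ] ℝ) →L[ℝ] X) (lam : ℕ → ℝ)
    (fs : ℕ → X →L[ℝ] ℝ) (xs : ℕ → X)
    -- the iterative decomposition scheme:
    (hγ0 : γs 0 = γ)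
    (hGauss : ∀ n, IsCenteredGaussian (γs n))
    (hRs : ∀ n (f g : X →L[ℝ] ℝ), g (Rs n f) = ∫ x, f x * g x ∂(γs n))
    (hsup : ∀ n, IsLUB {c : ℝ | ∃ f : X →L[ℝ] ℝ, ‖f‖ ≤ 1 ∧ c = f (Rs n f)} (lam n))
    (hfs : ∀ n, ‖fs n‖ = 1 ∧ (fs n) (Rs n (fs n)) = lam n)
    (hpos : ∀ n, 0 < lam n)
    (hxs : ∀ n, xs n = (lam n)⁻¹ • Rs n (fs n))
    (hγsucc : ∀ n, γs (n + 1) = (γs n).map (fun x => x - (fs n) x • xs n))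
    (hRrec : ∀ n (f : X →L[ℝ] ℝ), Rs (n + 1) f = Rs n f - (lam n * f (xs n)) • xs n)
    (Ps : ℕ → X → X)
    (hP0 : ∀ x, Ps 0 x = 0)
    (hPsucc : ∀ n x, Ps (n + 1) x = Ps n x + (fs n) (x - Ps n x) • xs n) :
    ∀ n : ℕ,
      (∃ T : X →L[ℝ] X, ∀ x, T x = Ps (n + 1) x) ∧
      (∀ x, Ps (n + 1) (Ps (n + 1) x) = Ps (n + 1) x) ∧
      Set.range (Ps (n + 1)) = (Submodule.span ℝ (xs '' {k | k ≤ n}) : Submodule ℝ X) ∧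
      {x : X | Ps (n + 1) x = 0} = {x : X | ∀ k ≤ n, fs k x = 0} := by
  obtain ⟨hone, horth⟩ := deflation_apply_direction
    (fun n f g => by rw [hRs, hRs]; simp_rw [mul_comm])
    (fun n => (hfs n).2) (fun n => (hpos n).ne') hxs hRrec
  intro n
  obtain ⟨T, hT⟩ := exists_continuousLinearMap_of_recursion hP0 hPsucc (n + 1)
  have hmem : ∀ x, Ps (n + 1) x ∈ Submodule.span ℝ (xs '' {k | k ≤ n}) := fun x => by
    simpa only [Nat.lt_succ_iff] using recursion_mem_span hP0 hPsucc (n + 1) x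
  have hfix : ∀ y ∈ Submodule.span ℝ (xs '' {k | k ≤ n}), Ps (n + 1) y = y := by
    intro y hy
    have heq : Set.EqOn T (ContinuousLinearMap.id ℝ X) (xs '' {k | k ≤ n}) := by
      rintro _ ⟨k, hk, rfl⟩
      rw [hT]
      exact recursion_apply_direction hone horth hP0 hPsucc (n + 1) k (Nat.lt_succ_of_le hk)
    rw [← hT]
    exact LinearMap.eqOn_span (f := (T : X →ₗ[ℝ] X)) (g := LinearMap.id) heq hy
  refine ⟨⟨T, hT⟩, fun x => hfix _ (hmem x), ?_, ?_⟩
  · ext y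
    exact ⟨fun ⟨x, hx⟩ => hx ▸ hmem x, fun hy => ⟨y, hfix y hy⟩⟩
  · ext x
    refine ⟨fun hx k hk => ?_, fun hx => ?_⟩
    · have hres := apply_residual_eq_zero hone horth hPsucc (n + 1) x k (Nat.lt_succ_of_le hk)
      rwa [show Ps (n + 1) x = 0 from hx, sub_zero] at hres
    · exact recursion_eq_zero_of_forall_apply_eq_zero hP0 hPsucc (n + 1) x
        fun k hk => hx k (Nat.le_of_lt_succ hk)
end

section
/- Under the iterative decomposition scheme applied to a centered Gaussian measure γ on a separable Banach space X, with λ_n > 0 for all n: for every n and every Borel set B ⊆ X, γ(B) = ∫_{ℝ^{n+1}} γ_{n+1}(B − Σ_{k=0}^{n} t_k x_k) Π_{k=0}^{n} (2πλ_k)^{-1/2} e^{−t_k²/(2λ_k)} dt₀⋯dt_n, where γ_{n+1} = γ∘(I−P_n)⁻¹ and P_n x = Σ_{k=0}^{n} ⟨x − P_{k−1}x, f_k⟩ x_k (P_{-1} = 0). -/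
open MeasureTheory ProbabilityTheory

/-- A finite product of Gaussian densities is a density of the product of the Gaussian measures. -/
lemma pi_gaussianReal_eq_withDensity {ι : Type*} [Fintype ι] (m : ι → ℝ) {v : ι → NNReal}
    (hv : ∀ i, v i ≠ 0) :
    Measure.pi (fun i => gaussianReal (m i) (v i)) =
      (volume : Measure (ι → ℝ)).withDensity
        (fun t => ENNReal.ofReal (∏ i, gaussianPDFReal (m i) (v i) (t i))) := by
  refine Measure.pi_eq fun s hs => ?_
  have hint : ∀ i, Integrable (gaussianPDFReal (m i) (v i)) (volume.restrict (s i)) :=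
    fun i => (integrable_gaussianPDFReal _ _).restrict
  rw [withDensity_apply _ (MeasurableSet.univ_pi hs), volume_pi, Measure.restrict_pi_pi,
    ← ofReal_integral_eq_lintegral_ofReal (Integrable.fintype_prod hint)
      (ae_of_all _ fun t => Finset.prod_nonneg fun i _ => gaussianPDFReal_nonneg _ _ _),
    integral_fintype_prod_eq_prod (fun i => gaussianPDFReal (m i) (v i)),
    ENNReal.ofReal_prod_of_nonneg fun i _ => integral_nonneg fun _ => gaussianPDFReal_nonneg _ _ _]
  exact Finset.prod_congr rfl fun i _ => (gaussianReal_apply_eq_integral _ (hv i) _).symm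

lemma image_sub_const_eq_preimage_add {X : Type*} [AddGroup X] (c : X) (B : Set X) :
    (fun x => x - c) '' B = (fun x => x + c) ⁻¹' B := by
  simp only [sub_eq_add_neg]
  rw [Set.image_add_right, neg_neg]

section Translate

variable {X T : Type*} [AddGroup X] [MeasurableSpace X] [MeasurableAdd₂ X] [MeasurableSpace T]
  (μ : Measure X) [SFinite μ] {g : T → X}

lemma measurable_measure_image_sub (hg : Measurable g) {B : Set X} (hB : MeasurableSet B) :
    Measurable fun t => μ ((fun x => x - g t) '' B) := by
  simp_rw [image_sub_const_eq_preimage_add]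
  have hm : Measurable fun p : T × X => p.2 + g p.1 := by fun_prop
  exact measurable_measure_prodMk_left (hm hB)

lemma measure_conv_map_apply (ν : Measure T) [SFinite ν] (hg : Measurable g) {B : Set X}
    (hB : MeasurableSet B) :
    (μ ∗ ν.map g) B = ∫⁻ t, μ ((fun x => x - g t) '' B) ∂ν := by
  have hadd : Measurable fun p : X × X => p.1 + p.2 := measurable_add
  rw [Measure.conv, Measure.map_apply hadd hB, Measure.prod_apply_symm (hadd hB),
    lintegral_map (measurable_measure_prodMk_right (hadd hB)) hg]
  exact lintegral_congr fun t => by rw [image_sub_const_eq_preimage_add]; rfl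

end Translate

section CenteredGaussian

variable {X : Type*} [NormedAddCommGroup X] [NormedSpace ℝ X] [MeasurableSpace X] [BorelSpace X]

lemma IsCenteredGaussian.charFunDual_eq {γ : Measure X} (hγ : IsCenteredGaussian γ)
    (L : X →L[ℝ] ℝ) :
    charFunDual γ L = Complex.exp (-((∫ x, L x * L x ∂γ : ℝ) : ℂ) / 2) := by
  obtain ⟨v, hv⟩ := hγ.2 L
  have hvar : ∫ x, L x * L x ∂γ = v := by
    have hm : ∫ x, L x * L x ∂γ = ∫ y, y * y ∂(γ.map L) := by
      rw [integral_map L.continuous.measurable.aemeasurable (by fun_prop)]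
    have h := variance_of_integral_eq_zero (X := id) (μ := gaussianReal 0 v) (by fun_prop) (by simp)
    rw [variance_id_gaussianReal] at h
    rw [hm, hv, h]
    simp [sq]
  rw [charFunDual_eq_charFun_map_one, hv, charFun_gaussianReal, hvar]
  simp [neg_div]

lemma charFunDual_map_sum_smul_pi_gaussianReal [SecondCountableTopology X]
    {ι : Type*} [Fintype ι] (v : ι → NNReal) (x : ι → X) (L : X →L[ℝ] ℝ) :
    charFunDual ((Measure.pi fun i => gaussianReal 0 (v i)).map
        fun t : ι → ℝ => ∑ i, t i • x i) L =
      Complex.exp (-((∑ i, v i * (L (x i)) ^ 2 : ℝ) : ℂ) / 2) := by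
  have hm : Measurable fun t : ι → ℝ => ∑ i, t i • x i := by fun_prop
  rw [charFunDual_apply, integral_map hm.aemeasurable (by fun_prop)]
  have h (t : ι → ℝ) : Complex.exp ((L (∑ i, t i • x i) : ℝ) * Complex.I) =
      ∏ i, Complex.exp (((L (x i) : ℝ) : ℂ) * (t i) * Complex.I) := by
    rw [← Complex.exp_sum, map_sum, Complex.ofReal_sum, Finset.sum_mul]
    simp [mul_comm]
  simp_rw [h]
  rw [integral_fintype_prod_eq_prod
    (fun i (s : ℝ) => Complex.exp (((L (x i) : ℝ) : ℂ) * s * Complex.I))]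
  simp_rw [← charFun_apply_real, charFun_gaussianReal]
  rw [← Complex.exp_sum]
  congr 1
  push_cast
  rw [← Finset.sum_neg_distrib, Finset.sum_div]
  exact Finset.sum_congr rfl fun i _ => by ring

/-- If the variances of two centered Gaussian measures differ by those of finitely many independent
one-dimensional Gaussian components, the first measure is the convolution of the second with
the law of the sum of these components. -/
lemma IsCenteredGaussian.eq_conv_map_pi_gaussianReal [CompleteSpace X] [SecondCountableTopology X]
    {γ γ' : Measure X} (hγ : IsCenteredGaussian γ) (hγ' : IsCenteredGaussian γ')
    {ι : Type*} [Fintype ι] (v : ι → NNReal) (x : ι → X)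
    (h : ∀ L : X →L[ℝ] ℝ,
      ∫ y, L y * L y ∂γ = ∫ y, L y * L y ∂γ' + ∑ i, v i * (L (x i)) ^ 2) :
    γ = γ' ∗ (Measure.pi fun i => gaussianReal 0 (v i)).map
      fun t : ι → ℝ => ∑ i, t i • x i := by
  have := hγ.1
  have := hγ'.1
  have hm : Measurable fun t : ι → ℝ => ∑ i, t i • x i := by fun_prop
  have : IsProbabilityMeasure ((Measure.pi fun i => gaussianReal 0 (v i)).map
      fun t : ι → ℝ => ∑ i, t i • x i) := Measure.isProbabilityMeasure_map hm.aemeasurable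
  refine Measure.ext_of_charFunDual (funext fun L => ?_)
  rw [charFunDual_conv, hγ.charFunDual_eq, hγ'.charFunDual_eq,
    charFunDual_map_sum_smul_pi_gaussianReal, ← Complex.exp_add, h]
  congr 1
  push_cast
  ring

end CenteredGaussian

/-- deconditioning formula at step `n`:
`γ(B) = ∫_{ℝ^{n+1}} γ_{n+1}(B - Σ_{k≤n} t_k x_k) Π_{k≤n} (2πλ_k)^{-1/2} e^{-t_k²/(2λ_k)} dt`,
where `γ_{n+1} = γ ∘ (I - P_n)⁻¹`. -/
theorem scheme_deconditioning
    {X : Type*} [NormedAddCommGroup X] [NormedSpace ℝ X]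
    [CompleteSpace X] [TopologicalSpace.SeparableSpace X]
    [MeasurableSpace X] [BorelSpace X]
    (γ : Measure X) (γs : ℕ → Measure X)
    (Rs : ℕ → (X →L[ℝ] ℝ) →L[ℝ] X) (lam : ℕ → ℝ)
    (fs : ℕ → X →L[ℝ] ℝ) (xs : ℕ → X)
    -- the iterative decomposition scheme:
    (hγ0 : γs 0 = γ)
    (hGauss : ∀ n, IsCenteredGaussian (γs n))
    (hRs : ∀ n (f g : X →L[ℝ] ℝ), g (Rs n f) = ∫ x, f x * g x ∂(γs n))
    (hsup : ∀ n, IsLUB {c : ℝ | ∃ f : X →L[ℝ] ℝ, ‖f‖ ≤ 1 ∧ c = f (Rs n f)} (lam n))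
    (hfs : ∀ n, ‖fs n‖ = 1 ∧ (fs n) (Rs n (fs n)) = lam n)
    (hpos : ∀ n, 0 < lam n)
    (hxs : ∀ n, xs n = (lam n)⁻¹ • Rs n (fs n))
    (hγsucc : ∀ n, γs (n + 1) = (γs n).map (fun x => x - (fs n) x • xs n))
    (hRrec : ∀ n (f : X →L[ℝ] ℝ), Rs (n + 1) f = Rs n f - (lam n * f (xs n)) • xs n)
    (Ps : ℕ → X → X)
    (hP0 : ∀ x, Ps 0 x = 0)
    (hPsucc : ∀ n x, Ps (n + 1) x = Ps n x + (fs n) (x - Ps n x) • xs n) :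
    ∀ n : ℕ, ∀ B : Set X, MeasurableSet B →
      (γ B).toReal =
        ∫ t : Fin (n + 1) → ℝ,
          ((γ.map (fun x => x - Ps (n + 1) x))
              ((fun x => x - ∑ k : Fin (n + 1), t k • xs (k : ℕ)) '' B)).toReal *
            ∏ k : Fin (n + 1),
              ((Real.sqrt (2 * Real.pi * lam k))⁻¹ *
                Real.exp (-(t k ^ 2) / (2 * lam k))) := by
  intro n B hB
  have : SecondCountableTopology X := UniformSpace.secondCountable_of_separable X
  have hPs_meas (n : ℕ) : Measurable (Ps n) := by
    induction n with
    | zero => simp only [funext hP0, measurable_const]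
    | succ n ih =>
      rw [funext (hPsucc n)]
      fun_prop
  have hmap (n : ℕ) : γ.map (fun x => x - Ps n x) = γs n := by
    induction n with
    | zero => simp [hP0, hγ0]
    | succ n ih =>
      have := hPs_meas n
      rw [hγsucc, ← ih, Measure.map_map (by fun_prop) (by fun_prop)]
      congr 1
      funext x
      simp only [hPsucc, Function.comp_apply]
      abel
  have hvar (L : X →L[ℝ] ℝ) (m : ℕ) : L (Rs 0 L) =
      L (Rs m L) + ∑ k ∈ Finset.range m, lam k * (L (xs k)) ^ 2 := by
    induction m with
    | zero => simp
    | succ m ih =>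
      rw [ih, Finset.sum_range_succ, hRrec]
      simp only [map_sub, map_smul, smul_eq_mul]
      ring
  have hv (k : ℕ) : (lam k).toNNReal ≠ 0 := (Real.toNNReal_pos.mpr (hpos k)).ne'
  have hγ : IsCenteredGaussian γ := hγ0 ▸ hGauss 0
  have := hγ.1
  have := (hGauss (n + 1)).1
  have hconv := hγ.eq_conv_map_pi_gaussianReal (hGauss (n + 1))
    (fun k : Fin (n + 1) => (lam k).toNNReal) (fun k : Fin (n + 1) => xs k) fun L => by
      rw [← hRs, ← hγ0, ← hRs, hvar L (n + 1), Finset.sum_range]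
      simp [(hpos _).le]
  have hpdf (t : Fin (n + 1) → ℝ) :
      ∏ k : Fin (n + 1), ((Real.sqrt (2 * Real.pi * lam k))⁻¹ *
        Real.exp (-(t k ^ 2) / (2 * lam k))) =
      ∏ k : Fin (n + 1), gaussianPDFReal 0 (lam k).toNNReal (t k) := by
    simp [gaussianPDFReal, (hpos _).le]
  simp_rw [hmap, hpdf]
  have hnonneg (t : Fin (n + 1) → ℝ) :
      0 ≤ ∏ k : Fin (n + 1), gaussianPDFReal 0 (lam k).toNNReal (t k) :=
    Finset.prod_nonneg fun k _ => gaussianPDFReal_nonneg _ _ _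
  have hdens : Measurable fun t : Fin (n + 1) → ℝ =>
      ENNReal.ofReal (∏ k : Fin (n + 1), gaussianPDFReal 0 (lam k).toNNReal (t k)) := by fun_prop
  have hsection : Measurable fun t : Fin (n + 1) → ℝ =>
      γs (n + 1) ((fun x => x - ∑ k : Fin (n + 1), t k • xs k) '' B) :=
    measurable_measure_image_sub _ (by fun_prop) hB
  conv_lhs => rw [hconv]
  rw [measure_conv_map_apply _ _ (by fun_prop) hB,
    pi_gaussianReal_eq_withDensity _ fun k : Fin (n + 1) => hv k,
    ← integral_toReal hsection.aemeasurable (ae_of_all _ fun _ => measure_lt_top _ _),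
    integral_withDensity_eq_integral_toReal_smul hdens (ae_of_all _ fun _ => ENNReal.ofReal_lt_top)]
  refine integral_congr_ae (ae_of_all _ fun t => ?_)
  simp only [ENNReal.toReal_ofReal (hnonneg t), smul_eq_mul]
  ring
end

section
/- Under the iterative decomposition scheme applied to a centered Gaussian measure γ on a separable Banach space X, with λ_n > 0 for all n: if f ∈ X* satisfies ⟨x_n, f⟩ = 0 for every n ∈ ℕ, then R_γ f = 0. (This expresses that the system (λ_n^{1/2} x_n) is total in the Cameron–Martin space of γ.) -/
open MeasureTheory ProbabilityTheory

open Filter Topology in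
/-- A bounded sequence of functionals has a subsequence whose consecutive differences tend to zero
in `L²(μ)`, provided `μ` has a finite second moment. -/
theorem exists_subseq_tendsto_integral_sq_sub
    {X : Type*} [NormedAddCommGroup X] [NormedSpace ℝ X]
    [TopologicalSpace.SeparableSpace X] [MeasurableSpace X] [BorelSpace X]
    {μ : Measure X} (hμ : Integrable (fun x => ‖x‖ ^ 2) μ)
    {r : ℝ} {u : ℕ → X →L[ℝ] ℝ} (hu : ∀ n, ‖u n‖ ≤ r) :
    ∃ φ : ℕ → ℕ, StrictMono φ ∧
      Tendsto (fun k => ∫ x, (u (φ (k + 1)) x - u (φ k) x) ^ 2 ∂μ) atTop (𝓝 0) := by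
  have : SecondCountableTopology X := UniformSpace.secondCountable_of_separable X
  obtain ⟨g, -, φ, hφ, hlim⟩ := WeakDual.isSeqCompact_closedBall ℝ X 0 r
    (x := fun n => StrongDual.toWeakDual (u n)) (fun n => by simpa using hu n)
  have hpt (x : X) : Tendsto (fun k => u (φ k) x) atTop (𝓝 (g x)) :=
    tendsto_iff_forall_eval_tendsto_topDualPairing.1 hlim x
  refine ⟨φ, hφ, ?_⟩
  have key := tendsto_integral_of_dominated_convergence (μ := μ)
    (F := fun k x => (u (φ (k + 1)) x - u (φ k) x) ^ 2) (f := fun _ => 0)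
    (fun x => (2 * r) ^ 2 * ‖x‖ ^ 2) (fun k => by fun_prop) (hμ.const_mul _)
    (fun k => ae_of_all _ fun x => ?_) (ae_of_all _ fun x => ?_)
  · simpa using key
  · have h (n : ℕ) : |u n x| ≤ r * ‖x‖ := (u n).le_of_opNorm_le (hu n) x
    rw [Real.norm_eq_abs, abs_pow, ← mul_pow]
    refine pow_le_pow_left₀ (abs_nonneg _) ?_ 2
    linarith [abs_sub (u (φ (k + 1)) x) (u (φ k) x), h (φ (k + 1)), h (φ k)]
  · simpa using (((hpt x).comp (tendsto_add_atTop_nat 1)).sub (hpt x)).pow 2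

theorem IsCenteredGaussian.integrable_norm_sq
    {X : Type*} [NormedAddCommGroup X] [NormedSpace ℝ X]
    [CompleteSpace X] [TopologicalSpace.SeparableSpace X]
    [MeasurableSpace X] [BorelSpace X] {γ : Measure X} (h : IsCenteredGaussian γ) :
    Integrable (fun x => ‖x‖ ^ 2) γ := by
  have : SecondCountableTopology X := UniformSpace.secondCountable_of_separable X
  have : IsGaussian γ := isGaussian_of_map_eq_gaussianReal fun L => ⟨0, h.2 L⟩
  exact (IsGaussian.memLp_two_id (μ := γ)).integrable_norm_pow (by norm_num)

/-- if `f ∈ X*` satisfies `⟨x_n, f⟩ = 0` for all `n`, then `R_γ f = 0`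
(the system `(√λ_n x_n)` is total in the Cameron–Martin space of `γ`). -/
theorem scheme_total_system
    {X : Type*} [NormedAddCommGroup X] [NormedSpace ℝ X]
    [CompleteSpace X] [TopologicalSpace.SeparableSpace X]
    [MeasurableSpace X] [BorelSpace X]
    (γ : Measure X) (γs : ℕ → Measure X)
    (Rs : ℕ → (X →L[ℝ] ℝ) →L[ℝ] X) (lam : ℕ → ℝ)
    (fs : ℕ → X →L[ℝ] ℝ) (xs : ℕ → X)
    -- the iterative decomposition scheme:
    (hγ0 : γs 0 = γ)
    (hGauss : ∀ n, IsCenteredGaussian (γs n))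
    (hRs : ∀ n (f g : X →L[ℝ] ℝ), g (Rs n f) = ∫ x, f x * g x ∂(γs n))
    (hsup : ∀ n, IsLUB {c : ℝ | ∃ f : X →L[ℝ] ℝ, ‖f‖ ≤ 1 ∧ c = f (Rs n f)} (lam n))
    (hfs : ∀ n, ‖fs n‖ = 1 ∧ (fs n) (Rs n (fs n)) = lam n)
    (hpos : ∀ n, 0 < lam n)
    (hxs : ∀ n, xs n = (lam n)⁻¹ • Rs n (fs n))
    (hγsucc : ∀ n, γs (n + 1) = (γs n).map (fun x => x - (fs n) x • xs n))
    (hRrec : ∀ n (f : X →L[ℝ] ℝ), Rs (n + 1) f = Rs n f - (lam n * f (xs n)) • xs n)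
    (f : X →L[ℝ] ℝ) (hf : ∀ n, f (xs n) = 0) :
    Rs 0 f = 0 := by
  have hsymm (n : ℕ) (f g : X →L[ℝ] ℝ) : g (Rs n f) = f (Rs n g) := by
    simp_rw [hRs, mul_comm]
  have hxf (n : ℕ) (g : X →L[ℝ] ℝ) : lam n * g (xs n) = fs n (Rs n g) := by
    rw [hsymm n g, hxs, map_smul, smul_eq_mul, mul_inv_cancel_left₀ (hpos n).ne']
  have hkill (n m : ℕ) (hnm : n + 1 ≤ m) : Rs m (fs n) = 0 := by
    induction m, hnm using Nat.le_induction with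
    | base =>
      rw [hRrec, hxf, (hfs n).2, hxs, smul_inv_smul₀ (hpos n).ne', sub_self]
    | succ m _ ih => rw [hRrec, hxf, ih, map_zero, zero_smul, sub_zero]
  have hanti (n : ℕ) (g : X →L[ℝ] ℝ) : g (Rs n g) ≤ g (Rs 0 g) := by
    induction n with
    | zero => exact le_rfl
    | succ n ih =>
      refine le_trans ?_ ih
      rw [hRrec, map_sub, map_smul, smul_eq_mul]
      nlinarith [mul_nonneg (hpos n).le (mul_self_nonneg (g (xs n)))]
  have hconst (n : ℕ) : Rs n f = Rs 0 f := by
    induction n with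
    | zero => rfl
    | succ n ih => rw [hRrec, hf, mul_zero, zero_smul, sub_zero, ih]
  have hlam_le (n m : ℕ) (hnm : n < m) :
      lam m ≤ ∫ x, (fs m x - fs n x) ^ 2 ∂(γs 0) := by
    have h1 : (fs m - fs n) (Rs m (fs m - fs n)) = lam m := by
      rw [map_sub, hkill n m hnm, sub_zero, sub_apply, (hfs m).2,
        hsymm m (fs m) (fs n), hkill n m hnm, map_zero, sub_zero]
    have h2 := hanti m (fs m - fs n)
    rw [h1, hRs] at h2
    simpa [sq] using h2
  have hbound (n : ℕ) : f (Rs 0 f) ≤ ‖f‖ ^ 2 * lam n := by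
    rcases eq_or_ne f 0 with rfl | hf0
    · simp
    have hf0 : ‖f‖ ≠ 0 := norm_ne_zero_iff.2 hf0
    have h := (hsup n).1 ⟨‖f‖⁻¹ • f, by rw [norm_smul, norm_inv, norm_norm, inv_mul_cancel₀ hf0], rfl⟩
    rw [map_smul, hconst, smul_apply, map_smul, smul_eq_mul, smul_eq_mul] at h
    calc f (Rs 0 f) = ‖f‖ ^ 2 * (‖f‖⁻¹ * (‖f‖⁻¹ * f (Rs 0 f))) := by field_simp
      _ ≤ ‖f‖ ^ 2 * lam n := by gcongr
  have hint := (hGauss 0).integrable_norm_sq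
  obtain ⟨φ, hφ, hlim⟩ := exists_subseq_tendsto_integral_sq_sub hint fun n => (hfs n).1.le
  have hle : f (Rs 0 f) ≤ 0 := by
    refine ge_of_tendsto' (by simpa using hlim.const_mul (‖f‖ ^ 2)) fun k =>
      (hbound (φ (k + 1))).trans ?_
    gcongr
    exact hlam_le _ _ (hφ k.lt_succ_self)
  have hsq : Integrable (fun x => f x * f x) (γs 0) := by
    refine (hint.const_mul (‖f‖ ^ 2)).mono' (by fun_prop) (ae_of_all _ fun x => ?_)
    rw [norm_mul, ← sq, ← mul_pow]
    exact pow_le_pow_left₀ (norm_nonneg _) (f.le_opNorm x) 2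
  have hzero : ∀ᵐ x ∂(γs 0), f x = 0 := by
    rw [hRs] at hle
    have h := (integral_eq_zero_iff_of_nonneg (fun x => mul_self_nonneg (f x)) hsq).1
      (hle.antisymm (integral_nonneg fun x => mul_self_nonneg (f x)))
    filter_upwards [h] with x hx using mul_self_eq_zero.1 hx
  refine SeparatingDual.eq_zero_of_forall_dual_eq_zero (R := ℝ) fun g => ?_
  rw [hRs]
  refine integral_eq_zero_of_ae ?_
  filter_upwards [hzero] with x hx
  simp [hx]
end

section
/- Let μ be a finite signed Borel measure on [0,1] with total variation norm ‖μ‖ ≤ 1. Then ∬_{[0,1]×[0,1]} min(s,t) dμ(s) dμ(t) ≤ 1, and equality holds if and only if μ = δ₁ or μ = −δ₁, where δ₁ is the Dirac measure at the point 1. (This identifies the first step of the decomposition of the classical Wiener measure: λ₀ = 1 and f₀ = δ₁.) -/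
open MeasureTheory

/-- The quadratic form `μ ↦ ∬ min(s,t) dμ(s) dμ(t)` of a finite signed Borel measure on
`[0,1]`, computed through the Jordan decomposition `μ = μ⁺ - μ⁻`. -/
noncomputable def wienerQF (μ : SignedMeasure (Set.Icc (0 : ℝ) 1)) : ℝ :=
  let p := μ.toJordanDecomposition.posPart
  let q := μ.toJordanDecomposition.negPart
  (∫ s, ∫ t, min (s : ℝ) (t : ℝ) ∂p ∂p) - (∫ s, ∫ t, min (s : ℝ) (t : ℝ) ∂q ∂p)
    - (∫ s, ∫ t, min (s : ℝ) (t : ℝ) ∂p ∂q) + (∫ s, ∫ t, min (s : ℝ) (t : ℝ) ∂q ∂q)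

lemma integrable_coe_Icc (p : Measure (Set.Icc (0 : ℝ) 1)) [IsFiniteMeasure p] :
    Integrable (fun s : Set.Icc (0 : ℝ) 1 => (s : ℝ)) p :=
  Integrable.of_bound (by fun_prop) 1
    (Filter.Eventually.of_forall fun s => by
      rw [Real.norm_eq_abs, abs_of_nonneg s.2.1]; exact s.2.2)

lemma integral_coe_Icc_le (p : Measure (Set.Icc (0 : ℝ) 1)) [IsFiniteMeasure p] :
    ∫ s, (s : ℝ) ∂p ≤ p.real Set.univ := by
  have h := integral_mono (integrable_coe_Icc p) (integrable_const (1 : ℝ)) (fun s => s.2.2)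
  simpa using h

lemma integral_integral_min_nonneg (p q : Measure (Set.Icc (0 : ℝ) 1)) :
    0 ≤ ∫ s, ∫ t, min (s : ℝ) (t : ℝ) ∂q ∂p :=
  integral_nonneg fun s => integral_nonneg fun t => le_min s.2.1 t.2.1

lemma integral_integral_min_le (p : Measure (Set.Icc (0 : ℝ) 1)) [IsFiniteMeasure p] :
    ∫ s, ∫ t, min (s : ℝ) (t : ℝ) ∂p ∂p ≤ p.real Set.univ * ∫ s, (s : ℝ) ∂p := by
  have inner_le (s : Set.Icc (0 : ℝ) 1) :
      ∫ t, min (s : ℝ) (t : ℝ) ∂p ≤ ∫ t, (t : ℝ) ∂p :=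
    integral_mono_of_nonneg (Filter.Eventually.of_forall fun t => le_min s.2.1 t.2.1)
      (integrable_coe_Icc p) (Filter.Eventually.of_forall fun t => min_le_right _ _)
  have h := integral_mono_of_nonneg (μ := p)
    (Filter.Eventually.of_forall fun s : Set.Icc (0 : ℝ) 1 =>
      integral_nonneg fun t : Set.Icc (0 : ℝ) 1 => le_min s.2.1 t.2.1)
    (integrable_const (∫ t, (t : ℝ) ∂p)) (Filter.Eventually.of_forall inner_le)
  simpa using h

lemma eq_dirac_one_of_one_le_integral (p : Measure (Set.Icc (0 : ℝ) 1)) [IsFiniteMeasure p]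
    (hp : p.real Set.univ = 1) (h : 1 ≤ ∫ s, (s : ℝ) ∂p) :
    p = Measure.dirac (⟨1, by norm_num⟩ : Set.Icc (0 : ℝ) 1) := by
  have hint : ∫ s : Set.Icc (0 : ℝ) 1, (1 - (s : ℝ)) ∂p = 0 := by
    rw [integral_sub (integrable_const _) (integrable_coe_Icc p)]
    have := integral_coe_Icc_le p
    simp only [integral_const, smul_eq_mul]
    linarith
  have hae := (integral_eq_zero_iff_of_nonneg (fun s => sub_nonneg.2 s.2.2)
    ((integrable_const _).sub (integrable_coe_Icc p))).1 hint
  have hone : (fun s => s) =ᵐ[p] fun _ => (⟨1, by norm_num⟩ : Set.Icc (0 : ℝ) 1) := by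
    filter_upwards [hae] with s hs
    exact Subtype.ext (by simpa using (sub_eq_zero.1 hs).symm)
  have hmap := Measure.map_congr (mβ := inferInstance) hone
  have huniv : p Set.univ = 1 := by
    rw [← ofReal_measureReal, hp, ENNReal.ofReal_one]
  rwa [Measure.map_id', Measure.map_const, huniv, one_smul] at hmap

/-- The Jordan decomposition of a finite positive measure. -/
lemma toJordanDecomposition_measure_toSignedMeasure {α : Type*} [MeasurableSpace α]
    (p : Measure α) [IsFiniteMeasure p] :
    p.toSignedMeasure.toJordanDecomposition =
      ⟨p, 0, Measure.MutuallySingular.zero_right⟩ :=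
  SignedMeasure.toJordanDecomposition_eq (by simp [JordanDecomposition.toSignedMeasure])

lemma wienerQF_neg (μ : SignedMeasure (Set.Icc (0 : ℝ) 1)) : wienerQF (-μ) = wienerQF μ := by
  simp only [wienerQF, SignedMeasure.toJordanDecomposition_neg,
    JordanDecomposition.neg_posPart, JordanDecomposition.neg_negPart]
  ring

lemma wienerQF_dirac_one :
    wienerQF (Measure.dirac (⟨1, by norm_num⟩ : Set.Icc (0 : ℝ) 1)).toSignedMeasure = 1 := by
  simp [wienerQF, toJordanDecomposition_measure_toSignedMeasure]

lemma measureReal_posPart_add_negPart_le_one {μ : SignedMeasure (Set.Icc (0 : ℝ) 1)}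
    (hμ : (μ.totalVariation Set.univ).toReal ≤ 1) :
    μ.toJordanDecomposition.posPart.real Set.univ
      + μ.toJordanDecomposition.negPart.real Set.univ ≤ 1 := by
  rwa [SignedMeasure.totalVariation, Measure.add_apply,
    ENNReal.toReal_add (measure_ne_top _ _) (measure_ne_top _ _)] at hμ

lemma wienerQF_le (μ : SignedMeasure (Set.Icc (0 : ℝ) 1)) :
    wienerQF μ ≤
      μ.toJordanDecomposition.posPart.real Set.univ
          * ∫ s, (s : ℝ) ∂μ.toJordanDecomposition.posPart
        + μ.toJordanDecomposition.negPart.real Set.univ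
          * ∫ s, (s : ℝ) ∂μ.toJordanDecomposition.negPart := by
  have hp := integral_integral_min_le μ.toJordanDecomposition.posPart
  have hq := integral_integral_min_le μ.toJordanDecomposition.negPart
  have hpq := integral_integral_min_nonneg μ.toJordanDecomposition.posPart
    μ.toJordanDecomposition.negPart
  have hqp := integral_integral_min_nonneg μ.toJordanDecomposition.negPart
    μ.toJordanDecomposition.posPart
  simp only [wienerQF]
  linarith

lemma wienerQF_le_sq_add_sq (μ : SignedMeasure (Set.Icc (0 : ℝ) 1)) :
    wienerQF μ ≤ μ.toJordanDecomposition.posPart.real Set.univ ^ 2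
      + μ.toJordanDecomposition.negPart.real Set.univ ^ 2 := by
  have h := wienerQF_le μ
  have hp := mul_le_mul_of_nonneg_left (integral_coe_Icc_le μ.toJordanDecomposition.posPart)
    (measureReal_nonneg (μ := μ.toJordanDecomposition.posPart) (s := Set.univ))
  have hq := mul_le_mul_of_nonneg_left (integral_coe_Icc_le μ.toJordanDecomposition.negPart)
    (measureReal_nonneg (μ := μ.toJordanDecomposition.negPart) (s := Set.univ))
  linarith

lemma eq_dirac_one_of_negPart_eq_zero {μ : SignedMeasure (Set.Icc (0 : ℝ) 1)}
    (hμ : (μ.totalVariation Set.univ).toReal ≤ 1) (h : wienerQF μ = 1)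
    (hneg : μ.toJordanDecomposition.negPart.real Set.univ = 0) :
    μ = (Measure.dirac (⟨1, by norm_num⟩ : Set.Icc (0 : ℝ) 1)).toSignedMeasure := by
  have hsum := measureReal_posPart_add_negPart_le_one hμ
  have hsq := wienerQF_le_sq_add_sq μ
  have hle := wienerQF_le μ
  have hpos := measureReal_nonneg (μ := μ.toJordanDecomposition.posPart) (s := Set.univ)
  rw [hneg] at hsum hsq hle
  have hone : μ.toJordanDecomposition.posPart.real Set.univ = 1 := by nlinarith
  rw [hone] at hle
  have hdirac := eq_dirac_one_of_one_le_integral _ hone (by linarith)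
  have hzero : μ.toJordanDecomposition.negPart = 0 :=
    Measure.measure_univ_eq_zero.1 ((measureReal_eq_zero_iff).1 hneg)
  rw [← SignedMeasure.toSignedMeasure_toJordanDecomposition μ]
  simp only [JordanDecomposition.toSignedMeasure, hdirac, hzero, Measure.toSignedMeasure_zero,
    sub_zero]

/-- if `‖μ‖ ≤ 1` (total variation norm) then
`∬ min(s,t) dμ(s) dμ(t) ≤ 1`, with equality iff `μ = δ₁` or `μ = -δ₁`. -/
theorem wiener_first_step (μ : SignedMeasure (Set.Icc (0 : ℝ) 1))
    (hμ : (μ.totalVariation Set.univ).toReal ≤ 1) :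
    wienerQF μ ≤ 1 ∧
    (wienerQF μ = 1 ↔
      μ = (Measure.dirac (⟨1, by norm_num⟩ : Set.Icc (0 : ℝ) 1)).toSignedMeasure ∨
      μ = -(Measure.dirac (⟨1, by norm_num⟩ : Set.Icc (0 : ℝ) 1)).toSignedMeasure) := by
  have hsum := measureReal_posPart_add_negPart_le_one hμ
  have hsq := wienerQF_le_sq_add_sq μ
  have hp := measureReal_nonneg (μ := μ.toJordanDecomposition.posPart) (s := Set.univ)
  have hq := measureReal_nonneg (μ := μ.toJordanDecomposition.negPart) (s := Set.univ)
  refine ⟨by nlinarith, fun h => ?_, ?_⟩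
  · have hmul : μ.toJordanDecomposition.posPart.real Set.univ
        * μ.toJordanDecomposition.negPart.real Set.univ = 0 := by
      nlinarith [mul_nonneg hp hq]
    rcases mul_eq_zero.1 hmul with h0 | h0
    · right
      rw [← neg_eq_iff_eq_neg]
      refine eq_dirac_one_of_negPart_eq_zero ?_ ((wienerQF_neg μ).trans h) ?_
      · rwa [SignedMeasure.totalVariation_neg]
      · rwa [SignedMeasure.toJordanDecomposition_neg, JordanDecomposition.neg_negPart]
    · exact Or.inl (eq_dirac_one_of_negPart_eq_zero hμ h h0)
  · rintro (rfl | rfl)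
    · exact wienerQF_dirac_one
    · rw [wienerQF_neg, wienerQF_dirac_one]
end

section
/- Let μ be a finite signed Borel measure on [0,1] with total variation norm ‖μ‖ ≤ 1. Then ∬_{[0,1]×[0,1]} (min(s,t) − st) dμ(s) dμ(t) ≤ 1/4, and equality holds if and only if μ = δ_{1/2} or μ = −δ_{1/2}, where δ_{1/2} is the Dirac measure at the point 1/2. (This identifies the second step of the decomposition of the classical Wiener measure: λ₁ = 1/4 and f₁ = δ_{1/2}, the kernel min(s,t) − st being the covariance of the Brownian bridge.) -/
open MeasureTheory

/-- The quadratic form `μ ↦ ∬ (min(s,t) - st) dμ(s) dμ(t)` of a finite signed Borel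
measure on `[0,1]` (the kernel `min(s,t) - st` is the covariance of the Brownian
bridge), computed through the Jordan decomposition `μ = μ⁺ - μ⁻`. -/
noncomputable def bridgeQF (μ : SignedMeasure (Set.Icc (0 : ℝ) 1)) : ℝ :=
  let p := μ.toJordanDecomposition.posPart
  let q := μ.toJordanDecomposition.negPart
  (∫ s, ∫ t, (min (s : ℝ) (t : ℝ) - (s : ℝ) * (t : ℝ)) ∂p ∂p)
    - (∫ s, ∫ t, (min (s : ℝ) (t : ℝ) - (s : ℝ) * (t : ℝ)) ∂q ∂p)
    - (∫ s, ∫ t, (min (s : ℝ) (t : ℝ) - (s : ℝ) * (t : ℝ)) ∂p ∂q)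
    + (∫ s, ∫ t, (min (s : ℝ) (t : ℝ) - (s : ℝ) * (t : ℝ)) ∂q ∂q)

lemma bridgeKernel_nonneg (s t : Set.Icc (0 : ℝ) 1) :
    0 ≤ min (s : ℝ) (t : ℝ) - (s : ℝ) * (t : ℝ) := by
  obtain ⟨s, hs0, hs1⟩ := s
  obtain ⟨t, ht0, ht1⟩ := t
  rcases le_total s t with h | h
  · simp only [min_eq_left h]
    nlinarith
  · simp only [min_eq_right h]
    nlinarith

lemma bridgeKernel_le_diag (s t : Set.Icc (0 : ℝ) 1) :
    min (s : ℝ) (t : ℝ) - (s : ℝ) * (t : ℝ) ≤ 1 / 4 - ((s : ℝ) - 1 / 2) ^ 2 := by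
  obtain ⟨s, hs0, hs1⟩ := s
  obtain ⟨t, ht0, ht1⟩ := t
  rcases le_total s t with h | h
  · simp only [min_eq_left h]
    nlinarith
  · simp only [min_eq_right h]
    nlinarith

lemma integrable_sq_sub_half (p : Measure (Set.Icc (0 : ℝ) 1)) [IsFiniteMeasure p] :
    Integrable (fun s : Set.Icc (0 : ℝ) 1 => ((s : ℝ) - 1 / 2) ^ 2) p :=
  Continuous.integrable_of_hasCompactSupport (by fun_prop) (HasCompactSupport.of_compactSpace _)

lemma integral_bridgeKernel_nonneg (p q : Measure (Set.Icc (0 : ℝ) 1)) :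
    0 ≤ ∫ s, ∫ t, (min (s : ℝ) (t : ℝ) - (s : ℝ) * (t : ℝ)) ∂q ∂p :=
  integral_nonneg fun s => integral_nonneg fun t => bridgeKernel_nonneg s t

lemma integral_bridgeKernel_le (p : Measure (Set.Icc (0 : ℝ) 1)) [IsFiniteMeasure p] :
    ∫ s, ∫ t, (min (s : ℝ) (t : ℝ) - (s : ℝ) * (t : ℝ)) ∂p ∂p ≤
      p.real Set.univ * (p.real Set.univ / 4 - ∫ s, ((s : ℝ) - 1 / 2) ^ 2 ∂p) := by
  have hint : Integrable (fun s : Set.Icc (0 : ℝ) 1 => 1 / 4 - ((s : ℝ) - 1 / 2) ^ 2) p :=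
    (integrable_const _).sub (integrable_sq_sub_half p)
  calc ∫ s, ∫ t, (min (s : ℝ) (t : ℝ) - (s : ℝ) * (t : ℝ)) ∂p ∂p
      ≤ ∫ s, p.real Set.univ * (1 / 4 - ((s : ℝ) - 1 / 2) ^ 2) ∂p := by
        refine integral_mono_of_nonneg
          (.of_forall fun s => integral_nonneg fun t => bridgeKernel_nonneg s t)
          (hint.const_mul _) (.of_forall fun s => ?_)
        refine (integral_mono_of_nonneg (.of_forall fun t => bridgeKernel_nonneg s t)
          (integrable_const _) (.of_forall fun t => bridgeKernel_le_diag s t)).trans_eq ?_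
        rw [integral_const, smul_eq_mul]
    _ = p.real Set.univ * (p.real Set.univ / 4 - ∫ s, ((s : ℝ) - 1 / 2) ^ 2 ∂p) := by
        rw [integral_const_mul, integral_sub (integrable_const _) (integrable_sq_sub_half p),
          integral_const, smul_eq_mul]
        ring

lemma eq_dirac_half_of_integral_sq_eq_zero (p : Measure (Set.Icc (0 : ℝ) 1)) [IsFiniteMeasure p]
    (hp : p.real Set.univ = 1) (hv : ∫ s, ((s : ℝ) - 1 / 2) ^ 2 ∂p = 0) :
    p = Measure.dirac (⟨1 / 2, by norm_num⟩ : Set.Icc (0 : ℝ) 1) := by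
  have hae := (integral_eq_zero_iff_of_nonneg (fun s => sq_nonneg _)
    (integrable_sq_sub_half p)).1 hv
  have hid : (id : Set.Icc (0 : ℝ) 1 → Set.Icc (0 : ℝ) 1) =ᵐ[p] fun _ => ⟨1 / 2, by norm_num⟩ := by
    filter_upwards [hae] with s hs
    exact Subtype.ext (sub_eq_zero.1 (pow_eq_zero_iff two_ne_zero |>.1 hs))
  have huniv : p Set.univ = 1 := by
    rwa [measureReal_def, ENNReal.toReal_eq_one_iff] at hp
  rw [← Measure.map_id (μ := p), Measure.map_congr hid, Measure.map_const, huniv, one_smul]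

lemma bridgeQF_neg (μ : SignedMeasure (Set.Icc (0 : ℝ) 1)) : bridgeQF (-μ) = bridgeQF μ := by
  simp only [bridgeQF, SignedMeasure.toJordanDecomposition_neg, JordanDecomposition.neg_posPart,
    JordanDecomposition.neg_negPart]
  ring

lemma bridgeQF_dirac_half :
    bridgeQF (Measure.dirac (⟨1 / 2, by norm_num⟩ : Set.Icc (0 : ℝ) 1)).toSignedMeasure
      = 1 / 4 := by
  let j : JordanDecomposition (Set.Icc (0 : ℝ) 1) :=
    { posPart := Measure.dirac ⟨1 / 2, by norm_num⟩
      negPart := 0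
      mutuallySingular := Measure.MutuallySingular.zero_right }
  have hj : (Measure.dirac (⟨1 / 2, by norm_num⟩ : Set.Icc (0 : ℝ) 1)).toSignedMeasure
      = j.toSignedMeasure := by
    simp [JordanDecomposition.toSignedMeasure, j]
  rw [bridgeQF, SignedMeasure.toJordanDecomposition_eq hj]
  simp only [j, integral_zero_measure, integral_dirac, integral_zero, min_self]
  norm_num

lemma SignedMeasure.eq_dirac_half_of_jordan (μ : SignedMeasure (Set.Icc (0 : ℝ) 1))
    (hp : μ.toJordanDecomposition.posPart.real Set.univ = 1)
    (hq : μ.toJordanDecomposition.negPart.real Set.univ = 0)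
    (hv : ∫ s, ((s : ℝ) - 1 / 2) ^ 2 ∂μ.toJordanDecomposition.posPart = 0) :
    μ = (Measure.dirac (⟨1 / 2, by norm_num⟩ : Set.Icc (0 : ℝ) 1)).toSignedMeasure := by
  have hneg : μ.toJordanDecomposition.negPart = 0 :=
    Measure.measure_univ_eq_zero.1 ((measureReal_eq_zero_iff).1 hq)
  conv_lhs => rw [← μ.toSignedMeasure_toJordanDecomposition]
  simp only [JordanDecomposition.toSignedMeasure, hneg,
    eq_dirac_half_of_integral_sq_eq_zero _ hp hv, Measure.toSignedMeasure_zero, sub_zero]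

/-- if `‖μ‖ ≤ 1` (total variation norm) then
`∬ (min(s,t) - st) dμ(s) dμ(t) ≤ 1/4`, with equality iff `μ = δ_{1/2}` or
`μ = -δ_{1/2}`. -/
theorem wiener_second_step (μ : SignedMeasure (Set.Icc (0 : ℝ) 1))
    (hμ : (μ.totalVariation Set.univ).toReal ≤ 1) :
    bridgeQF μ ≤ 1 / 4 ∧
    (bridgeQF μ = 1 / 4 ↔
      μ = (Measure.dirac (⟨1 / 2, by norm_num⟩ : Set.Icc (0 : ℝ) 1)).toSignedMeasure ∨
      μ = -(Measure.dirac (⟨1 / 2, by norm_num⟩ : Set.Icc (0 : ℝ) 1)).toSignedMeasure) := by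
  have hle := integral_bridgeKernel_le μ.toJordanDecomposition.posPart
  have hle' := integral_bridgeKernel_le μ.toJordanDecomposition.negPart
  have hpq := integral_bridgeKernel_nonneg μ.toJordanDecomposition.posPart
    μ.toJordanDecomposition.negPart
  have hqp := integral_bridgeKernel_nonneg μ.toJordanDecomposition.negPart
    μ.toJordanDecomposition.posPart
  have hdirac := SignedMeasure.eq_dirac_half_of_jordan μ
  have hdirac' := SignedMeasure.eq_dirac_half_of_jordan (-μ)
  rw [SignedMeasure.toJordanDecomposition_neg, JordanDecomposition.neg_posPart,
    JordanDecomposition.neg_negPart] at hdirac'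
  have hmass : μ.toJordanDecomposition.posPart.real Set.univ +
      μ.toJordanDecomposition.negPart.real Set.univ ≤ 1 := by
    rwa [SignedMeasure.totalVariation, Measure.add_apply,
      ENNReal.toReal_add (measure_ne_top _ _) (measure_ne_top _ _)] at hμ
  have hv : 0 ≤ ∫ s, ((s : ℝ) - 1 / 2) ^ 2 ∂μ.toJordanDecomposition.posPart :=
    integral_nonneg fun s => sq_nonneg _
  have hw : 0 ≤ ∫ s, ((s : ℝ) - 1 / 2) ^ 2 ∂μ.toJordanDecomposition.negPart :=
    integral_nonneg fun s => sq_nonneg _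
  have hP : 0 ≤ μ.toJordanDecomposition.posPart.real Set.univ := measureReal_nonneg
  have hQ : 0 ≤ μ.toJordanDecomposition.negPart.real Set.univ := measureReal_nonneg
  generalize μ.toJordanDecomposition.posPart.real Set.univ = P at *
  generalize μ.toJordanDecomposition.negPart.real Set.univ = Q at *
  generalize ∫ s, ((s : ℝ) - 1 / 2) ^ 2 ∂μ.toJordanDecomposition.posPart = v at *
  generalize ∫ s, ((s : ℝ) - 1 / 2) ^ 2 ∂μ.toJordanDecomposition.negPart = w at *
  have hPv := mul_nonneg hP hv
  have hQw := mul_nonneg hQ hw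
  have hPQ := mul_nonneg hP hQ
  have hbound : bridgeQF μ ≤ (P + Q) ^ 2 / 4 - P * Q / 2 - P * v - Q * w := by
    rw [bridgeQF]
    linarith
  have hsq : (P + Q) ^ 2 ≤ 1 := pow_le_one₀ (add_nonneg hP hQ) hmass
  refine ⟨by linarith, fun heq => ?_, ?_⟩
  · have hsum : P + Q = 1 := by nlinarith
    have hPQ0 : P * Q = 0 := by linarith
    have hPv0 : P * v = 0 := by linarith
    have hQw0 : Q * w = 0 := by linarith
    rcases mul_eq_zero.1 hPQ0 with rfl | rfl
    · obtain rfl : Q = 1 := by linarith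
      exact .inr (neg_eq_iff_eq_neg.1 (hdirac' rfl rfl (by linarith)))
    · obtain rfl : P = 1 := by linarith
      exact .inl (hdirac rfl rfl (by linarith))
  · rintro (rfl | rfl)
    · exact bridgeQF_dirac_half
    · rw [bridgeQF_neg, bridgeQF_dirac_half]
end

section
/- Let X be a separable real Banach space and μ a Borel probability measure on X with finite second moment, ∫_X ‖x‖² μ(dx) < ∞. Then the supremum sup{∫_X ⟨x,f⟩² μ(dx) : f ∈ X*, ‖f‖_{X*} ≤ 1} is finite and attained: there exists f₀ ∈ X* with ‖f₀‖_{X*} = 1 such that ∫_X ⟨x,f₀⟩² μ(dx) equals this supremum. -/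
open MeasureTheory

open Filter Topology

theorem integrable_sq_continuousLinearMap {X : Type*} [NormedAddCommGroup X] [NormedSpace ℝ X]
    [MeasurableSpace X] [BorelSpace X] {μ : Measure X}
    (h2 : Integrable (fun x => ‖x‖ ^ 2) μ) (f : X →L[ℝ] ℝ) :
    Integrable (fun x => (f x) ^ 2) μ := by
  refine (h2.const_mul (‖f‖ ^ 2)).mono'
    (f.continuous.pow 2).measurable.aestronglyMeasurable (ae_of_all _ fun x => ?_)
  rw [norm_pow, ← mul_pow]
  gcongr
  exact f.le_opNorm x

theorem sq_apply_le_sq_norm {X : Type*} [NormedAddCommGroup X] [NormedSpace ℝ X]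
    {f : X →L[ℝ] ℝ} (hf : ‖f‖ ≤ 1) (x : X) : (f x) ^ 2 ≤ ‖x‖ ^ 2 := by
  simpa [sq_le_sq] using f.le_of_opNorm_le hf x

theorem exists_norm_eq_one_smul_eq {X : Type*} [NormedAddCommGroup X] [NormedSpace ℝ X]
    [Nontrivial X] (g : X →L[ℝ] ℝ) : ∃ f : X →L[ℝ] ℝ, ‖f‖ = 1 ∧ g = ‖g‖ • f := by
  rcases eq_or_ne g 0 with rfl | hg
  · obtain ⟨f, hf, -⟩ := exists_dual_vector' ℝ (0 : X)
    exact ⟨f, hf, by simp⟩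
  · have hg' : ‖g‖ ≠ 0 := norm_ne_zero_iff.mpr hg
    exact ⟨‖g‖⁻¹ • g, by simp [norm_smul, hg'], by rw [smul_smul, mul_inv_cancel₀ hg', one_smul]⟩

/-- for a Borel probability measure `μ` on a separable Banach space `X`
with finite second moment, the supremum `sup {∫ ⟨x,f⟩² dμ : f ∈ X*, ‖f‖ ≤ 1}` is finite
and attained at some `f₀` of unit norm. -/
theorem second_moment_sup_attained {X : Type*} [NormedAddCommGroup X] [NormedSpace ℝ X]
    [CompleteSpace X] [TopologicalSpace.SeparableSpace X] [Nontrivial X]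
    [MeasurableSpace X] [BorelSpace X]
    (μ : Measure X) [IsProbabilityMeasure μ]
    (h2 : Integrable (fun x => ‖x‖ ^ 2) μ) :
    ∃ f₀ : X →L[ℝ] ℝ, ‖f₀‖ = 1 ∧
      IsLUB {c : ℝ | ∃ f : X →L[ℝ] ℝ, ‖f‖ ≤ 1 ∧ c = ∫ x, (f x) ^ 2 ∂μ}
        (∫ x, (f₀ x) ^ 2 ∂μ) := by
  set S := {c : ℝ | ∃ f : X →L[ℝ] ℝ, ‖f‖ ≤ 1 ∧ c = ∫ x, (f x) ^ 2 ∂μ}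
  have hne : S.Nonempty := ⟨_, 0, by simp, rfl⟩
  have hbdd : BddAbove S := by
    refine ⟨∫ x, ‖x‖ ^ 2 ∂μ, ?_⟩
    rintro _ ⟨f, hf, rfl⟩
    exact integral_mono (integrable_sq_continuousLinearMap h2 f) h2 (sq_apply_le_sq_norm hf)
  obtain ⟨u, -, hu, huS⟩ := exists_seq_tendsto_sSup hne hbdd
  choose f hf hfu using huS
  obtain ⟨g, hg, φ, hφ, hlim⟩ := WeakDual.isSeqCompact_closedBall ℝ X 0 1
    (x := fun n => StrongDual.toWeakDual (f n)) (fun n => by simpa using hf n)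
  have hg1 : ‖WeakDual.toStrongDual g‖ ≤ 1 := by simpa using hg
  have hpt (x : X) : Tendsto (fun n => f (φ n) x) atTop (𝓝 (WeakDual.toStrongDual g x)) :=
    ((WeakDual.eval_continuous x).tendsto g).comp hlim
  have hint : Tendsto (fun n => ∫ x, (f (φ n) x) ^ 2 ∂μ) atTop
      (𝓝 (∫ x, (WeakDual.toStrongDual g x) ^ 2 ∂μ)) := by
    refine tendsto_integral_of_dominated_convergence (fun x => ‖x‖ ^ 2)
      (fun n => (integrable_sq_continuousLinearMap h2 _).aestronglyMeasurable) h2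
      (fun n => ae_of_all _ fun x => ?_) (ae_of_all _ fun x => (hpt x).pow 2)
    rw [Real.norm_of_nonneg (sq_nonneg _)]
    exact sq_apply_le_sq_norm (hf _) x
  have hsup : sSup S = ∫ x, (WeakDual.toStrongDual g x) ^ 2 ∂μ := by
    refine tendsto_nhds_unique (hu.comp hφ.tendsto_atTop) (hint.congr fun n => ?_)
    exact (hfu (φ n)).symm
  obtain ⟨f₀, hf₀, hgf⟩ := exists_norm_eq_one_smul_eq (WeakDual.toStrongDual g)
  refine ⟨f₀, hf₀, fun c hc => ?_, fun c hc => hc ⟨f₀, hf₀.le, rfl⟩⟩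
  refine (le_csSup hbdd hc).trans (hsup.trans_le ?_)
  refine integral_mono (integrable_sq_continuousLinearMap h2 _)
    (integrable_sq_continuousLinearMap h2 _) fun x => ?_
  have hx : WeakDual.toStrongDual g x = ‖WeakDual.toStrongDual g‖ * f₀ x := by
    conv_lhs => rw [hgf]
    rfl
  simp only [hx, mul_pow]
  exact mul_le_of_le_one_left (sq_nonneg _) (pow_le_one₀ (norm_nonneg _) hg1)
end
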